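/- If ρ_BC saturates the Araki–Lieb inequality, S(ρ_BC) + S(ρ_C) − S(ρ_B) = 0, then any extension ρ_ABC of ρ_BC to a tripartite state satisfies both I(A:C)_ρ = 0 and I(A:C|B)_ρ = 0. -/

import Mathlib

open Matrix Kronecker ComplexOrder

/-- Von Neumann entropy `S(ρ) = -Tr(ρ ln ρ)`, computed via eigenvalues. -/
noncomputable def vN {n : Type} [Fintype n] [DecidableEq n] (ρ : Matrix n n ℂ) : ℝ :=
  if h : ρ.IsHermitian then -∑ i, h.eigenvalues i * Real.log (h.eigenvalues i) else 0

/-- A density matrix: positive semidefinite with unit trace. -/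
def IsDensity {n : Type} [Fintype n] (ρ : Matrix n n ℂ) : Prop :=
  ρ.PosSemidef ∧ ρ.trace = 1

/-- Partial trace over the left tensor factor. -/
noncomputable def ptraceLeft {a b : Type} [Fintype a] [Fintype b]
    (M : Matrix (a × b) (a × b) ℂ) : Matrix b b ℂ :=
  Matrix.of fun i j => ∑ k, M (k, i) (k, j)

/-- Partial trace over the right tensor factor. -/
noncomputable def ptraceRight {a b : Type} [Fintype a] [Fintype b]
    (M : Matrix (a × b) (a × b) ℂ) : Matrix a a ℂ :=
  Matrix.of fun i j => ∑ k, M (i, k) (j, k)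

/-- Marginal on `BC` of a state on `A ⊗ B ⊗ C`. -/
noncomputable def mBC {A B C : Type} [Fintype A] [Fintype B] [Fintype C]
    (ρ : Matrix (A × B × C) (A × B × C) ℂ) : Matrix (B × C) (B × C) ℂ :=
  Matrix.of fun x y => ∑ a, ρ (a, x) (a, y)

noncomputable def mAB {A B C : Type} [Fintype A] [Fintype B] [Fintype C]
    (ρ : Matrix (A × B × C) (A × B × C) ℂ) : Matrix (A × B) (A × B) ℂ :=
  Matrix.of fun x y => ∑ c, ρ (x.1, x.2, c) (y.1, y.2, c)

noncomputable def mAC {A B C : Type} [Fintype A] [Fintype B] [Fintype C]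
    (ρ : Matrix (A × B × C) (A × B × C) ℂ) : Matrix (A × C) (A × C) ℂ :=
  Matrix.of fun x y => ∑ b, ρ (x.1, b, x.2) (y.1, b, y.2)

noncomputable def mA {A B C : Type} [Fintype A] [Fintype B] [Fintype C]
    (ρ : Matrix (A × B × C) (A × B × C) ℂ) : Matrix A A ℂ :=
  Matrix.of fun x y => ∑ b, ∑ c, ρ (x, b, c) (y, b, c)

noncomputable def mB {A B C : Type} [Fintype A] [Fintype B] [Fintype C]
    (ρ : Matrix (A × B × C) (A × B × C) ℂ) : Matrix B B ℂ :=
  Matrix.of fun x y => ∑ a, ∑ c, ρ (a, x, c) (a, y, c)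

noncomputable def mC {A B C : Type} [Fintype A] [Fintype B] [Fintype C]
    (ρ : Matrix (A × B × C) (A × B × C) ℂ) : Matrix C C ℂ :=
  Matrix.of fun x y => ∑ a, ∑ b, ρ (a, b, x) (a, b, y)


noncomputable def polyEnt (p : Polynomial ℂ) : ℝ :=
  -(p.roots.map (fun z => z.re * Real.log z.re)).sum

lemma vN_eq_polyEnt {n : Type} [Fintype n] [DecidableEq n] {ρ : Matrix n n ℂ}
    (h : ρ.IsHermitian) : vN ρ = polyEnt ρ.charpoly := by
  rw [vN, dif_pos h, polyEnt, h.roots_charpoly_eq_eigenvalues, Multiset.map_map]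
  simp [Function.comp_def]

lemma polyEnt_X_pow_mul (k : ℕ) {p : Polynomial ℂ} (hp : p ≠ 0) :
    polyEnt (Polynomial.X ^ k * p) = polyEnt p := by
  rw [polyEnt, Polynomial.roots_mul (mul_ne_zero (pow_ne_zero _ Polynomial.X_ne_zero) hp)]
  simp [polyEnt, Multiset.map_nsmul, Multiset.sum_nsmul]

lemma vN_mul_conj_comm {m n : Type} [Fintype m] [DecidableEq m] [Fintype n] [DecidableEq n]
    (N : Matrix m n ℂ) : vN (N * Nᴴ) = vN (Nᴴ * N) := by
  rw [vN_eq_polyEnt (isHermitian_mul_conjTranspose_self N),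
    vN_eq_polyEnt (isHermitian_conjTranspose_mul_self N),
    ← polyEnt_X_pow_mul (Fintype.card n) (Matrix.charpoly_monic _).ne_zero,
    Matrix.charpoly_mul_comm', polyEnt_X_pow_mul _ (Matrix.charpoly_monic _).ne_zero]

lemma vN_transpose {n : Type} [Fintype n] [DecidableEq n] {ρ : Matrix n n ℂ}
    (h : ρ.IsHermitian) : vN ρᵀ = vN ρ := by
  rw [vN_eq_polyEnt h, vN_eq_polyEnt h.transpose, Matrix.charpoly_transpose]

lemma vN_mul_conj_comm' {m n : Type} [Fintype m] [DecidableEq m] [Fintype n] [DecidableEq n]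
    (N : Matrix m n ℂ) : vN (N * Nᴴ) = vN (Nᴴ * N)ᵀ := by
  rw [vN_mul_conj_comm, vN_transpose (isHermitian_conjTranspose_mul_self N)]

lemma vN_of_diag {n : Type} [Fintype n] [DecidableEq n] {ρ V : Matrix n n ℂ} {p : n → ℝ}
    (hV : Vᴴ * V = 1) (h : ρ = V * diagonal (fun i => (p i : ℂ)) * Vᴴ) :
    vN ρ = -∑ i, p i * Real.log (p i) := by
  have hh : ρ.IsHermitian := by
    rw [h]
    apply isHermitian_mul_mul_conjTranspose
    rw [Matrix.IsHermitian, diagonal_conjTranspose]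
    congr 1
    ext i
    simp
  rw [vN_eq_polyEnt hh, h, charpoly_mul_comm, ← mul_assoc, hV, one_mul, charpoly_diagonal,
    polyEnt, Polynomial.roots_prod _ _
      (Finset.prod_ne_zero_iff.2 fun i _ => Polynomial.X_sub_C_ne_zero _)]
  simp [Multiset.bind_singleton, Multiset.map_map]

lemma exists_diag {n : Type} [Fintype n] [DecidableEq n] {ρ : Matrix n n ℂ} (h : IsDensity ρ) :
    ∃ (V : Matrix n n ℂ) (p : n → ℝ), Vᴴ * V = 1 ∧ V * Vᴴ = 1 ∧
      ρ = V * diagonal (fun i => (p i : ℂ)) * Vᴴ ∧ (∀ i, 0 ≤ p i) ∧ ∑ i, p i = 1 ∧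
      vN ρ = -∑ i, p i * Real.log (p i) := by
  have hh := h.1.isHermitian
  have hV : (hh.eigenvectorUnitary : Matrix n n ℂ)ᴴ * hh.eigenvectorUnitary = 1 := by
    rw [← star_eq_conjTranspose]; simp
  have hd : ρ = hh.eigenvectorUnitary * diagonal (fun i => (hh.eigenvalues i : ℂ)) *
      (hh.eigenvectorUnitary : Matrix n n ℂ)ᴴ := by
    conv_lhs => rw [hh.spectral_theorem, Unitary.conjStarAlgAut_apply]
    rfl
  refine ⟨hh.eigenvectorUnitary, hh.eigenvalues, hV, ?_, hd, h.1.eigenvalues_nonneg, ?_, ?_⟩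
  · rw [← star_eq_conjTranspose]; simp
  · have := hh.trace_eq_sum_eigenvalues
    rw [h.2] at this
    apply Complex.ofReal_injective
    rw [Complex.ofReal_sum, Complex.ofReal_one]
    exact this.symm
  · exact vN_of_diag hV hd

lemma vN_kron {m n : Type} [Fintype m] [DecidableEq m] [Fintype n] [DecidableEq n]
    {ρ : Matrix m m ℂ} {σ : Matrix n n ℂ} (hρ : IsDensity ρ) (hσ : IsDensity σ) :
    vN (ρ ⊗ₖ σ) = vN ρ + vN σ := by
  obtain ⟨V, p, hV, -, hρ, hp, hp1, hpe⟩ := exists_diag hρ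
  obtain ⟨W, q, hW, -, hσ, hq, hq1, hqe⟩ := exists_diag hσ
  rw [hpe, hqe, vN_of_diag (ρ := ρ ⊗ₖ σ) (V := V ⊗ₖ W) (p := fun z => p z.1 * q z.2)]
  · rw [Fintype.sum_prod_type, ← neg_add]
    congr 1
    have : ∀ i j, p i * q j * Real.log (p i * q j) =
        q j * (p i * Real.log (p i)) + p i * (q j * Real.log (q j)) := by
      intro i j
      by_cases h1 : p i = 0
      · simp [h1]
      by_cases h2 : q j = 0
      · simp [h2]
      rw [Real.log_mul h1 h2]; ring
    simp_rw [this, Finset.sum_add_distrib, ← Finset.sum_mul, hq1, ← Finset.mul_sum]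
    rw [← Finset.sum_mul, hp1]
    simp
  · rw [conjTranspose_kronecker, ← mul_kronecker_mul, hV, hW, one_kronecker_one]
  · rw [hρ, hσ, mul_kronecker_mul, mul_kronecker_mul, conjTranspose_kronecker,
      diagonal_kronecker_diagonal]
    simp

lemma klein_eq {n : Type} [Fintype n] [DecidableEq n] {V T : Matrix n n ℂ} {p r q : n → ℝ}
    (hV : Vᴴ * V = 1) (hV' : V * Vᴴ = 1) (hT : Tᴴ * T = 1) (hT' : T * Tᴴ = 1)
    (hp : ∀ i, 0 ≤ p i) (hr : ∀ i, 0 ≤ r i) (hp1 : ∑ i, p i = 1) (hr1 : ∑ i, r i = 1)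
    (hq : ∀ z, (q z : ℂ) = (Tᴴ * (V * diagonal (fun i => (p i : ℂ)) * Vᴴ) * T) z z)
    (hrq : ∀ z, r z = 0 → q z = 0)
    (he : ∑ i, p i * Real.log (p i) = ∑ z, q z * Real.log (r z)) :
    V * diagonal (fun i => (p i : ℂ)) * Vᴴ = T * diagonal (fun i => (r i : ℂ)) * Tᴴ := by
  set W := Vᴴ * T with hW
  have hWW : Wᴴ * W = 1 := by
    rw [hW, conjTranspose_mul, conjTranspose_conjTranspose, Matrix.mul_assoc,
      ← Matrix.mul_assoc V, hV', Matrix.one_mul, hT]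
  have hWW' : W * Wᴴ = 1 := by
    rw [hW, conjTranspose_mul, conjTranspose_conjTranspose, Matrix.mul_assoc,
      ← Matrix.mul_assoc T, hT', Matrix.one_mul, hV]
  set P : n → n → ℝ := fun k z => Complex.normSq (W k z) with hP
  have hP0 : ∀ k z, 0 ≤ P k z := fun k z => Complex.normSq_nonneg _
  have hrow : ∀ k, ∑ z, P k z = 1 := by
    intro k
    have := congrFun (congrFun hWW' k) k
    rw [Matrix.mul_apply] at this
    simp only [conjTranspose_apply, RCLike.star_def, Complex.mul_conj, one_apply_eq] at this
    exact_mod_cast this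
  have hcol : ∀ z, ∑ k, P k z = 1 := by
    intro z
    have := congrFun (congrFun hWW z) z
    rw [Matrix.mul_apply] at this
    simp only [conjTranspose_apply, RCLike.star_def, mul_comm ((starRingEnd ℂ) _), Complex.mul_conj, one_apply_eq] at this
    exact_mod_cast this
  have hqP : ∀ z, q z = ∑ k, p k * P k z := by
    intro z
    have h1 : Tᴴ * (V * diagonal (fun i => (p i : ℂ)) * Vᴴ) * T =
        Wᴴ * (diagonal (fun i => (p i : ℂ)) * W) := by
      rw [hW, conjTranspose_mul, conjTranspose_conjTranspose]
      simp only [Matrix.mul_assoc]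
    have := hq z
    rw [h1, Matrix.mul_apply] at this
    simp only [conjTranspose_apply, RCLike.star_def, diagonal_mul] at this
    have h2 : ∀ k, (starRingEnd ℂ) (W k z) * ((p k : ℂ) * W k z) = ((p k * P k z : ℝ) : ℂ) := by
      intro k
      rw [mul_left_comm, mul_comm ((starRingEnd ℂ) _), Complex.mul_conj]
      push_cast; rfl
    simp only [h2] at this
    exact_mod_cast this
  have hpz : ∀ k z, r z = 0 → p k * P k z = 0 := by
    intro k z h
    have h1 := hrq z h
    rw [hqP, Finset.sum_eq_zero_iff_of_nonneg (fun k _ => mul_nonneg (hp k) (hP0 k z))] at h1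
    exact h1 k (Finset.mem_univ _)
  set F : n → n → ℝ := fun k z =>
    P k z * (p k * Real.log (p k) - p k * Real.log (r z) - p k + r z) with hF
  have key : ∀ k z, 0 ≤ F k z ∧ (F k z = 0 → P k z = 0 ∨ p k = r z) := by
    intro k z
    simp only [hF]
    rcases (hr z).eq_or_lt with h0 | h0
    · have := hpz k z h0.symm
      rcases mul_eq_zero.1 this with h | h
      · simp [h, ← h0]
      · simp [h]
    rcases (hp k).eq_or_lt with h1 | h1
    · rw [← h1]
      simp only [zero_mul, sub_zero, zero_add]
      refine ⟨mul_nonneg (hP0 k z) h0.le, fun h => ?_⟩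
      rcases mul_eq_zero.1 h with h | h
      · exact Or.inl h
      · exact Or.inr h.symm
    have e : p k * Real.log (p k) - p k * Real.log (r z) - p k + r z =
        p k * ((r z / p k - 1) - Real.log (r z / p k)) := by
      rw [Real.log_div h0.ne' h1.ne']; field_simp; ring
    rw [e]
    have hx : 0 < r z / p k := div_pos h0 h1
    refine ⟨mul_nonneg (hP0 k z) (mul_nonneg h1.le (sub_nonneg.2 (Real.log_le_sub_one_of_pos hx))),
      fun h => ?_⟩
    rcases mul_eq_zero.1 h with h | h
    · exact Or.inl h
    right
    by_contra hne
    have hx1 : r z / p k ≠ 1 := by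
      intro h'
      rw [div_eq_one_iff_eq h1.ne'] at h'
      exact hne h'.symm
    have := Real.log_lt_sub_one_of_pos hx hx1
    rcases mul_eq_zero.1 h with h | h
    · exact h1.ne' h
    · linarith
  have hsum : ∑ k, ∑ z, F k z = 0 := by
    have e : ∀ k z, F k z = P k z * (p k * Real.log (p k)) - (p k * P k z) * Real.log (r z)
        - P k z * p k + P k z * r z := by
      intro k z; simp only [hF]; ring
    simp only [e, Finset.sum_add_distrib, Finset.sum_sub_distrib, ← Finset.sum_mul, hrow, one_mul]
    rw [Finset.sum_comm (f := fun k z => p k * P k z * Real.log (r z)),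
      Finset.sum_comm (f := fun k z => P k z * r z)]
    simp only [← Finset.sum_mul, ← hqP, hcol, one_mul]
    rw [hp1, hr1, he]; ring
  have hall : ∀ k z, P k z = 0 ∨ p k = r z := by
    intro k z
    rw [Finset.sum_eq_zero_iff_of_nonneg
      (fun k _ => Finset.sum_nonneg (fun z _ => (key k z).1))] at hsum
    have h1 := hsum k (Finset.mem_univ _)
    rw [Finset.sum_eq_zero_iff_of_nonneg (fun z _ => (key k z).1)] at h1
    exact (key k z).2 (h1 z (Finset.mem_univ _))
  have hcomm : diagonal (fun i => (p i : ℂ)) * W = W * diagonal (fun i => (r i : ℂ)) := by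
    ext k z
    rw [diagonal_mul, mul_diagonal]
    rcases hall k z with h | h
    · rw [Complex.normSq_eq_zero.1 h]; simp
    · rw [h, mul_comm]
  calc V * diagonal (fun i => (p i : ℂ)) * Vᴴ
      = V * diagonal (fun i => (p i : ℂ)) * Vᴴ * (T * Tᴴ) := by rw [hT', Matrix.mul_one]
    _ = V * (diagonal (fun i => (p i : ℂ)) * W) * Tᴴ := by rw [hW]; simp only [Matrix.mul_assoc]
    _ = (V * Vᴴ) * T * diagonal (fun i => (r i : ℂ)) * Tᴴ := by
        rw [hcomm, hW]; simp only [Matrix.mul_assoc]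
    _ = _ := by rw [hV', Matrix.one_mul]

lemma trace_kron_one {X Y : Type} [Fintype X] [DecidableEq X] [Fintype Y] [DecidableEq Y]
    (σ : Matrix (X × Y) (X × Y) ℂ) (K : Matrix X X ℂ) :
    (σ * (K ⊗ₖ (1 : Matrix Y Y ℂ))).trace = (ptraceRight σ * K).trace := by
  simp only [Matrix.trace, diag_apply, Matrix.mul_apply, Fintype.sum_prod_type, kronecker_apply,
    ptraceRight, of_apply, Finset.sum_mul]
  refine Finset.sum_congr rfl fun i _ => ?_
  rw [Finset.sum_comm]
  refine Finset.sum_congr rfl fun j _ => ?_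
  refine Finset.sum_congr rfl fun k _ => ?_
  simp [one_apply]

lemma trace_one_kron {X Y : Type} [Fintype X] [DecidableEq X] [Fintype Y] [DecidableEq Y]
    (σ : Matrix (X × Y) (X × Y) ℂ) (K : Matrix Y Y ℂ) :
    (σ * ((1 : Matrix X X ℂ) ⊗ₖ K)).trace = (ptraceLeft σ * K).trace := by
  simp only [Matrix.trace, diag_apply, Matrix.mul_apply, Fintype.sum_prod_type, kronecker_apply,
    ptraceLeft, of_apply, Finset.sum_mul]
  rw [Finset.sum_comm]
  refine Finset.sum_congr rfl fun i _ => ?_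
  rw [Finset.sum_comm (s := (Finset.univ : Finset Y))]
  refine Finset.sum_congr rfl fun j _ => ?_
  rw [Finset.sum_comm]
  simp [one_apply]

lemma marg_right {X Y : Type} [Fintype X] [DecidableEq X] [Fintype Y] [DecidableEq Y]
    (σ : Matrix (X × Y) (X × Y) ℂ) (U : Matrix X X ℂ) (W : Matrix Y Y ℂ) (hU : Uᴴ * U = 1)
    (hW : W * Wᴴ = 1) (l : X → ℝ)
    (h : ptraceRight σ = U * diagonal (fun i => (l i : ℂ)) * Uᴴ) (i : X) :
    ∑ j, ((U ⊗ₖ W)ᴴ * σ * (U ⊗ₖ W)) (i, j) (i, j) = l i := by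
  have h1 : ∑ j, ((U ⊗ₖ W)ᴴ * σ * (U ⊗ₖ W)) (i, j) (i, j) =
      (((U ⊗ₖ W)ᴴ * σ * (U ⊗ₖ W)) * (Matrix.single i i (1 : ℂ) ⊗ₖ (1 : Matrix Y Y ℂ))).trace := by
    rw [trace_kron_one, Matrix.trace_mul_single]
    simp [ptraceRight]
  rw [h1, Matrix.mul_assoc, Matrix.mul_assoc, Matrix.trace_mul_comm, Matrix.mul_assoc,
    conjTranspose_kronecker, ← mul_kronecker_mul, ← mul_kronecker_mul, Matrix.mul_one, hW,
    trace_kron_one, h, ← Matrix.mul_assoc, Matrix.trace_mul_comm]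
  simp only [← Matrix.mul_assoc]
  rw [hU, Matrix.one_mul, Matrix.mul_assoc _ Uᴴ U, hU, Matrix.mul_one,
    Matrix.trace_mul_single]
  simp

lemma marg_left {X Y : Type} [Fintype X] [DecidableEq X] [Fintype Y] [DecidableEq Y]
    (σ : Matrix (X × Y) (X × Y) ℂ) (U : Matrix X X ℂ) (W : Matrix Y Y ℂ) (hU : U * Uᴴ = 1)
    (hW : Wᴴ * W = 1) (l : Y → ℝ)
    (h : ptraceLeft σ = W * diagonal (fun i => (l i : ℂ)) * Wᴴ) (j : Y) :
    ∑ i, ((U ⊗ₖ W)ᴴ * σ * (U ⊗ₖ W)) (i, j) (i, j) = l j := by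
  have h1 : ∑ i, ((U ⊗ₖ W)ᴴ * σ * (U ⊗ₖ W)) (i, j) (i, j) =
      (((U ⊗ₖ W)ᴴ * σ * (U ⊗ₖ W)) * ((1 : Matrix X X ℂ) ⊗ₖ Matrix.single j j (1 : ℂ))).trace := by
    rw [trace_one_kron, Matrix.trace_mul_single]
    simp [ptraceLeft]
  rw [h1, Matrix.mul_assoc, Matrix.mul_assoc, Matrix.trace_mul_comm, Matrix.mul_assoc,
    conjTranspose_kronecker, ← mul_kronecker_mul, ← mul_kronecker_mul, Matrix.mul_one, hU,
    trace_one_kron, h, ← Matrix.mul_assoc, Matrix.trace_mul_comm]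
  simp only [← Matrix.mul_assoc]
  rw [hW, Matrix.one_mul, Matrix.mul_assoc _ Wᴴ W, hW, Matrix.mul_one,
    Matrix.trace_mul_single]
  simp

lemma eq_kron_of_saturated {X Y : Type} [Fintype X] [DecidableEq X] [Fintype Y] [DecidableEq Y]
    {σ : Matrix (X × Y) (X × Y) ℂ} (hσ : IsDensity σ) (hX : IsDensity (ptraceRight σ))
    (hY : IsDensity (ptraceLeft σ)) (h : vN (ptraceRight σ) + vN (ptraceLeft σ) = vN σ) :
    σ = ptraceRight σ ⊗ₖ ptraceLeft σ := by
  obtain ⟨V, p, hV, hV', hσe, hp, hp1, hpe⟩ := exists_diag hσ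
  obtain ⟨U, l, hU, hU', hXe, hl, hl1, hle⟩ := exists_diag hX
  obtain ⟨W, m, hW, hW', hYe, hm, hm1, hme⟩ := exists_diag hY
  have hT : (U ⊗ₖ W)ᴴ * (U ⊗ₖ W) = 1 := by
    rw [conjTranspose_kronecker, ← mul_kronecker_mul, hU, hW, one_kronecker_one]
  have hT' : (U ⊗ₖ W) * (U ⊗ₖ W)ᴴ = 1 := by
    rw [conjTranspose_kronecker, ← mul_kronecker_mul, hU', hW', one_kronecker_one]
  have hpsd : ((U ⊗ₖ W)ᴴ * σ * (U ⊗ₖ W)).PosSemidef := hσ.1.conjTranspose_mul_mul_same _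
  set q : X × Y → ℝ := fun z => (((U ⊗ₖ W)ᴴ * σ * (U ⊗ₖ W)) z z).re with hqdef
  have hq0 : ∀ z, 0 ≤ q z := fun z => (Complex.nonneg_iff.1 (hpsd.diag_nonneg (i := z))).1
  have hqc : ∀ z, (q z : ℂ) = ((U ⊗ₖ W)ᴴ * σ * (U ⊗ₖ W)) z z := by
    intro z
    apply Complex.ext
    · simp [hqdef]
    · simpa using (Complex.nonneg_iff.1 (hpsd.diag_nonneg (i := z))).2
  have hqX : ∀ i, ∑ j, q (i, j) = l i := by
    intro i
    have := marg_right σ U W hU hW' l hXe i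
    simp only [← hqc] at this
    exact_mod_cast this
  have hqY : ∀ j, ∑ i, q (i, j) = m j := by
    intro j
    have := marg_left σ U W hU' hW m hYe j
    simp only [← hqc] at this
    exact_mod_cast this
  have hlq : ∀ i j, l i = 0 → q (i, j) = 0 := by
    intro i j h0
    rw [← hqX, Finset.sum_eq_zero_iff_of_nonneg (fun _ _ => hq0 _)] at h0
    exact h0 j (Finset.mem_univ _)
  have hmq : ∀ i j, m j = 0 → q (i, j) = 0 := by
    intro i j h0
    rw [← hqY, Finset.sum_eq_zero_iff_of_nonneg (fun _ _ => hq0 _)] at h0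
    exact h0 i (Finset.mem_univ _)
  have hlog : ∀ i j, q (i, j) * Real.log (l i * m j) =
      q (i, j) * Real.log (l i) + q (i, j) * Real.log (m j) := by
    intro i j
    by_cases h1 : l i = 0
    · simp [hlq i j h1]
    by_cases h2 : m j = 0
    · simp [hmq i j h2]
    rw [Real.log_mul h1 h2]; ring
  have hk := klein_eq (V := V) (T := U ⊗ₖ W) (p := p) (r := fun z => l z.1 * m z.2) (q := q)
    hV hV' hT hT' hp (fun z => mul_nonneg (hl _) (hm _)) hp1
    (by rw [Fintype.sum_prod_type]; simp only [← Finset.mul_sum, hm1, mul_one, hl1])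
    (by intro z; rw [← hσe]; exact hqc z)
    (by
      rintro ⟨i, j⟩ h0
      rcases mul_eq_zero.1 h0 with h0 | h0
      · exact hlq i j h0
      · exact hmq i j h0)
    (by
      have e1 : ∑ i, ∑ j, q (i, j) * Real.log (l i) = ∑ i, l i * Real.log (l i) :=
        Finset.sum_congr rfl fun i _ => by rw [← Finset.sum_mul, hqX]
      have e2 : ∑ i, ∑ j, q (i, j) * Real.log (m j) = ∑ j, m j * Real.log (m j) := by
        rw [Finset.sum_comm]
        exact Finset.sum_congr rfl fun j _ => by rw [← Finset.sum_mul, hqY]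
      have e3 : ∑ z : X × Y, q z * Real.log (l z.1 * m z.2) =
          ∑ i, ∑ j, (q (i, j) * Real.log (l i) + q (i, j) * Real.log (m j)) := by
        rw [Fintype.sum_prod_type]
        exact Finset.sum_congr rfl fun i _ => Finset.sum_congr rfl fun j _ => hlog i j
      rw [e3]
      simp only [Finset.sum_add_distrib]
      rw [e1, e2]
      linarith)
  rw [← hσe] at hk
  rw [hXe, hYe, mul_kronecker_mul, mul_kronecker_mul, ← conjTranspose_kronecker,
    diagonal_kronecker_diagonal]
  rw [hk]
  simp

lemma isDensity_of_eq {m n : Type} [Fintype m] [Fintype n] {σ : Matrix m m ℂ}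
    (N : Matrix m n ℂ) (h : σ = N * Nᴴ) (ht : σ.trace = 1) : IsDensity σ :=
  ⟨h ▸ posSemidef_self_mul_conjTranspose N, ht⟩

/-- If the `BC` marginal saturates Araki–Lieb, then any tripartite extension has
`I(A:C) = 0` and `I(A:C|B) = 0`. -/
theorem arakiLieb_saturation_extension {A B C : Type} [Fintype A] [DecidableEq A]
    [Fintype B] [DecidableEq B] [Fintype C] [DecidableEq C]
    (ρ : Matrix (A × B × C) (A × B × C) ℂ) (hρ : IsDensity ρ)
    (hsat : vN (mBC ρ) + vN (mC ρ) - vN (mB ρ) = 0) :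
    vN (mA ρ) + vN (mC ρ) - vN (mAC ρ) = 0 ∧
    vN (mAB ρ) + vN (mBC ρ) - vN (mB ρ) - vN ρ = 0 := by
  obtain ⟨M, hM⟩ : ∃ M : Matrix (A × B × C) (A × B × C) ℂ, ρ = M * Mᴴ := by
    obtain ⟨V, p, -, -, h, hp, -⟩ := exists_diag hρ
    refine ⟨V * diagonal (fun i => (Real.sqrt (p i) : ℂ)), ?_⟩
    rw [conjTranspose_mul, diagonal_conjTranspose, Matrix.mul_assoc V, ← Matrix.mul_assoc _ _ Vᴴ,
      diagonal_mul_diagonal, ← Matrix.mul_assoc, h]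
    congr 3
    ext i
    simp [← Complex.ofReal_mul, Real.mul_self_sqrt (hp i)]
  have hMe : ∀ x y, ρ x y = ∑ d, M x d * star (M y d) := by
    intro x y
    rw [hM, Matrix.mul_apply]; rfl
  have htr : ∑ a, ∑ b, ∑ c, ρ (a, b, c) (a, b, c) = 1 := by
    have := hρ.2
    simpa [Matrix.trace, Fintype.sum_prod_type] using this
  -- the purifying index is `A × B × C`
  set N1 : Matrix ((A × A × B × C) × C) B ℂ := of fun x b => M (x.1.1, b, x.2) x.1.2 with hN1
  set σ := N1 * N1ᴴ with hσ
  set N2 : Matrix (A × A × B × C) (B × C) ℂ := of fun x y => M (x.1, y.1, y.2) x.2 with hN2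
  set N3 : Matrix (A × B) ((A × B × C) × C) ℂ := of fun x y => M (x.1, x.2, y.2) y.1 with hN3
  have hσe : ∀ a d c a' d' c', σ ((a, d), c) ((a', d'), c') =
      ∑ b, M (a, b, c) d * star (M (a', b, c') d') := by
    intro a d c a' d' c'
    rw [hσ, Matrix.mul_apply]; rfl
  have hR : ptraceRight σ = N2 * N2ᴴ := by
    ext ⟨a, d⟩ ⟨a', d'⟩
    rw [Matrix.mul_apply, Fintype.sum_prod_type, Finset.sum_comm]
    simp only [ptraceRight, of_apply, hσe]
    rfl
  have hL : ptraceLeft σ = mC ρ := by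
    ext c c'
    simp only [ptraceLeft, mC, of_apply, Fintype.sum_prod_type (α₁ := A) (α₂ := A × B × C),
      hσe, hMe]
    refine Finset.sum_congr rfl fun a _ => ?_
    rw [Finset.sum_comm]
  have hB : mB ρ = (N1ᴴ * N1)ᵀ := by
    ext b b'
    rw [transpose_apply, Matrix.mul_apply, Fintype.sum_prod_type,
      Fintype.sum_prod_type (α₁ := A) (α₂ := A × B × C)]
    simp only [mB, of_apply, hMe]
    refine Finset.sum_congr rfl fun a _ => ?_
    rw [Finset.sum_comm]
    refine Finset.sum_congr rfl fun d _ => Finset.sum_congr rfl fun c _ => mul_comm _ _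
  have hBC : mBC ρ = (N2ᴴ * N2)ᵀ := by
    ext x y
    rw [transpose_apply, Matrix.mul_apply, Fintype.sum_prod_type]
    simp only [mBC, of_apply, hMe]
    refine Finset.sum_congr rfl fun a _ => Finset.sum_congr rfl fun d _ => mul_comm _ _
  have hAB : mAB ρ = N3 * N3ᴴ := by
    ext x y
    rw [Matrix.mul_apply, Fintype.sum_prod_type, Finset.sum_comm]
    simp only [mAB, of_apply, hMe]
    rfl
  have hSB : vN σ = vN (mB ρ) := by rw [hB, ← vN_mul_conj_comm']
  have hSBC : vN (ptraceRight σ) = vN (mBC ρ) := by rw [hBC, ← vN_mul_conj_comm', hR]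
  have trC : (mC ρ).trace = 1 := by
    rw [← htr]
    simp only [Matrix.trace, diag_apply, mC, of_apply]
    rw [Finset.sum_comm]
    refine Finset.sum_congr rfl fun a _ => ?_
    rw [Finset.sum_comm]
  have trR : (ptraceRight σ).trace = 1 := by
    rw [← trC, ← hL]
    simp only [Matrix.trace, diag_apply, ptraceRight, ptraceLeft, of_apply]
    rw [Finset.sum_comm]
  have trσ : σ.trace = 1 := by
    rw [← trR]
    simp only [Matrix.trace, diag_apply, ptraceRight, of_apply]
    rw [Fintype.sum_prod_type]
  have dσ : IsDensity σ := isDensity_of_eq N1 rfl trσ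
  have dR : IsDensity (ptraceRight σ) := isDensity_of_eq N2 hR trR
  have dC : IsDensity (mC ρ) := by
    refine isDensity_of_eq (n := (A × B) × A × B × C)
      (of fun c x => M (x.1.1, x.1.2, c) x.2) ?_ trC
    ext c c'
    rw [Matrix.mul_apply, Fintype.sum_prod_type, Fintype.sum_prod_type]
    simp only [mC, of_apply, hMe]
    rfl
  have dA : IsDensity (mA ρ) := by
    refine isDensity_of_eq (n := (B × C) × A × B × C)
      (of fun a x => M (a, x.1.1, x.1.2) x.2) ?_ ?_
    · ext c c'
      rw [Matrix.mul_apply, Fintype.sum_prod_type, Fintype.sum_prod_type]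
      simp only [mA, of_apply, hMe]
      rfl
    · rw [← htr]
      simp only [Matrix.trace, diag_apply, mA, of_apply]
  have hprod := eq_kron_of_saturated dσ dR (hL ▸ dC) (by rw [hSB, hSBC, hL]; linarith)
  rw [hL] at hprod
  have hpe : ∀ a d c a' d' c', ∑ b, M (a, b, c) d * star (M (a', b, c') d') =
      ptraceRight σ (a, d) (a', d') * mC ρ c c' := by
    intro a d c a' d' c'
    rw [← hσe]
    exact congrFun (congrFun hprod ((a, d), c)) ((a', d'), c')
  have hRe : ∀ a d a' d', ptraceRight σ (a, d) (a', d') =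
      ∑ c, ∑ b, M (a, b, c) d * star (M (a', b, c) d') := by
    intro a d a' d'
    simp only [ptraceRight, of_apply, hσe]
  have hAC : mAC ρ = mA ρ ⊗ₖ mC ρ := by
    ext ⟨a, c⟩ ⟨a', c'⟩
    rw [kronecker_apply]
    have h1 : mA ρ a a' = ∑ d, ptraceRight σ (a, d) (a', d) := by
      simp only [mA, of_apply, hMe, hRe]
      rw [Finset.sum_comm]
      rw [Finset.sum_comm (s := (Finset.univ : Finset (A × B × C)))]
      refine Finset.sum_congr rfl fun c _ => ?_
      rw [Finset.sum_comm]
    rw [h1, Finset.sum_mul]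
    simp only [← hpe, mAC, of_apply, hMe]
    rw [Finset.sum_comm]
  set τ : Matrix (A × B × C) (A × B × C) ℂ := ptraceLeft (ptraceRight σ) with hτ
  have hτe : τ = (Mᴴ * M)ᵀ := by
    ext d d'
    rw [transpose_apply, Matrix.mul_apply, Fintype.sum_prod_type]
    simp only [hτ, ptraceLeft, of_apply, hRe]
    refine Finset.sum_congr rfl fun a _ => ?_
    rw [Fintype.sum_prod_type, Finset.sum_comm]
    refine Finset.sum_congr rfl fun b _ => Finset.sum_congr rfl fun c _ => mul_comm _ _
  have hSτ : vN τ = vN ρ := by rw [hτe, ← vN_mul_conj_comm', hM]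
  have dτ : IsDensity τ := by
    refine isDensity_of_eq Mᵀ ?_ ?_
    · rw [hτe, transpose_mul]; rfl
    · rw [hτe, trace_transpose, Matrix.trace_mul_comm, ← hM, hρ.2]
  have hCD : (N3ᴴ * N3)ᵀ = τ ⊗ₖ mC ρ := by
    ext ⟨d, c⟩ ⟨d', c'⟩
    rw [kronecker_apply, transpose_apply, Matrix.mul_apply, Fintype.sum_prod_type]
    simp only [hτ, ptraceLeft, of_apply]
    rw [Finset.sum_mul]
    simp only [← hpe]
    refine Finset.sum_congr rfl fun a _ => Finset.sum_congr rfl fun b _ => mul_comm _ _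
  have hSAB : vN (mAB ρ) = vN ρ + vN (mC ρ) := by
    rw [hAB, vN_mul_conj_comm', hCD, vN_kron dτ dC, hSτ]
  have hSAC : vN (mAC ρ) = vN (mA ρ) + vN (mC ρ) := by rw [hAC, vN_kron dA dC]
  constructor <;> linarith
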